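/- arXiv:1212.3684 — 2 statements merged into one kernel-verified Lean document; each statement's English description precedes it below -/
import Mathlib

section
/- For dyadic cubes Q, R define A_{QR} = [ℓ(Q)^{α/2} ℓ(R)^{α/2} / (D(Q,R)^α · sup_{z ∈ Q ∪ R} λ(z, D(Q,R)))] · μ(Q)^{1/2} μ(R)^{1/2}, where D(Q,R) = ℓ(Q) + ℓ(R) + d(Q,R). Then for every nonnegative sequence (x_Q) indexed by dyadic cubes, (Σ_R [Σ_Q A_{QR} x_Q]²)^{1/2} ≲ (Σ_Q x_Q²)^{1/2}, with implied constant depending only on n, α, C_λ. -/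
open MeasureTheory Set
open scoped ENNReal

noncomputable section

/-- The standard (half-open) dyadic cube `2^{-k}([0,1)^n + m)` in `ℝⁿ`. -/
def dcube (n : ℕ) (k : ℤ) (m : Fin n → ℤ) : Set (Fin n → ℝ) :=
  {x | ∀ i, (m i : ℝ) * (2:ℝ) ^ (-k) ≤ x i ∧ x i < ((m i : ℝ) + 1) * (2:ℝ) ^ (-k)}

/-- The `ℓ^∞` distance between two sets in `ℝⁿ`. -/
def sdist {n : ℕ} (A B : Set (Fin n → ℝ)) : ℝ :=
  sInf (Set.image2 dist A B)

/-- `D(Q,R) = ℓ(Q) + ℓ(R) + d(Q,R)` for the dyadic cubes `Q`, `R` indexed by `p`, `q`. -/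
def Ddist (n : ℕ) (p q : ℤ × (Fin n → ℤ)) : ℝ :=
  (2:ℝ) ^ (-p.1) + (2:ℝ) ^ (-q.1) + sdist (dcube n p.1 p.2) (dcube n q.1 q.2)

/-- The matrix
`A_{QR} = [ℓ(Q)^{α/2} ℓ(R)^{α/2} / (D(Q,R)^α · sup_{z ∈ Q ∪ R} λ(z, D(Q,R)))] μ(Q)^{1/2} μ(R)^{1/2}`. -/
def Amat (n : ℕ) (α : ℝ) (μ : Measure (Fin n → ℝ)) (lam : (Fin n → ℝ) → ℝ → ℝ)
    (p q : ℤ × (Fin n → ℤ)) : ℝ≥0∞ :=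
  ENNReal.ofReal
      ((((2:ℝ) ^ (-p.1)) ^ (α / 2) * ((2:ℝ) ^ (-q.1)) ^ (α / 2)) /
        (Ddist n p q ^ α *
          ⨆ z : (dcube n p.1 p.2 ∪ dcube n q.1 q.2 : Set (Fin n → ℝ)), lam z (Ddist n p q))) *
    μ (dcube n p.1 p.2) ^ ((1:ℝ) / 2) * μ (dcube n q.1 q.2) ^ ((1:ℝ) / 2)

/-- The kernel `ℓ(Q)^{α/2} ℓ(R)^{α/2} / (D(Q,R)^α · sup_{z ∈ Q ∪ R} λ(z, D(Q,R)))`. -/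
def Akernel (n : ℕ) (α : ℝ) (lam : (Fin n → ℝ) → ℝ → ℝ) (p q : ℤ × (Fin n → ℤ)) : ℝ≥0∞ :=
  ENNReal.ofReal
      ((((2:ℝ) ^ (-p.1)) ^ (α / 2) * ((2:ℝ) ^ (-q.1)) ^ (α / 2)) /
        (Ddist n p q ^ α *
          ⨆ z : (dcube n p.1 p.2 ∪ dcube n q.1 q.2 : Set (Fin n → ℝ)), lam z (Ddist n p q)))

lemma sdist_comm {n : ℕ} (A B : Set (Fin n → ℝ)) : sdist A B = sdist B A := by
  unfold sdist
  rw [Set.image2_swap]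
  simp only [dist_comm]

lemma sdist_nonneg {n : ℕ} (A B : Set (Fin n → ℝ)) : 0 ≤ sdist A B := by
  apply Real.sInf_nonneg
  rintro _ ⟨a, _, b, _, rfl⟩
  exact dist_nonneg

lemma Ddist_comm (n : ℕ) (p q : ℤ × (Fin n → ℤ)) : Ddist n p q = Ddist n q p := by
  unfold Ddist
  rw [sdist_comm]
  ring

lemma Akernel_comm (n : ℕ) (α : ℝ) (lam : (Fin n → ℝ) → ℝ → ℝ) (p q : ℤ × (Fin n → ℤ)) :
    Akernel n α lam p q = Akernel n α lam q p := by
  unfold Akernel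
  rw [Ddist_comm n p q, Set.union_comm, mul_comm (((2:ℝ) ^ (-p.1)) ^ (α / 2))]

lemma max_le_Ddist (n : ℕ) (p q : ℤ × (Fin n → ℤ)) :
    max ((2:ℝ) ^ (-p.1)) ((2:ℝ) ^ (-q.1)) ≤ Ddist n p q := by
  have h1 : (0:ℝ) < 2 ^ (-p.1) := by positivity
  have h2 : (0:ℝ) < 2 ^ (-q.1) := by positivity
  have h3 := sdist_nonneg (dcube n p.1 p.2) (dcube n q.1 q.2)
  unfold Ddist
  apply max_le <;> linarith

/-- The lower corner of a dyadic cube. -/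
def dcorner (n : ℕ) (q : ℤ × (Fin n → ℤ)) : Fin n → ℝ := fun i => (q.2 i : ℝ) * (2:ℝ) ^ (-q.1)

lemma dcorner_mem (n : ℕ) (q : ℤ × (Fin n → ℤ)) : dcorner n q ∈ dcube n q.1 q.2 := by
  intro i
  have h : (0:ℝ) < 2 ^ (-q.1) := by positivity
  refine ⟨le_rfl, ?_⟩
  unfold dcorner
  nlinarith

lemma dist_le_of_mem_dcube {n : ℕ} {k : ℤ} {m : Fin n → ℤ} {x y : Fin n → ℝ}
    (hx : x ∈ dcube n k m) (hy : y ∈ dcube n k m) : dist x y ≤ (2:ℝ) ^ (-k) := by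
  rw [dist_pi_le_iff (by positivity)]
  intro i
  rw [Real.dist_eq, abs_le]
  have := hx i
  have := hy i
  constructor <;> linarith

lemma dist_le_Ddist {n : ℕ} {p q : ℤ × (Fin n → ℤ)} {x y : Fin n → ℝ}
    (hx : x ∈ dcube n p.1 p.2) (hy : y ∈ dcube n q.1 q.2) : dist x y ≤ Ddist n p q := by
  have : dist x y - (2:ℝ) ^ (-p.1) - (2:ℝ) ^ (-q.1) ≤
      sdist (dcube n p.1 p.2) (dcube n q.1 q.2) := by
    refine le_csInf (Set.Nonempty.image2 ⟨x, hx⟩ ⟨y, hy⟩) ?_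
    rintro _ ⟨a, ha, b, hb, rfl⟩
    have := dist_triangle4 x a b y
    have := dist_le_of_mem_dcube hx ha
    have := dist_le_of_mem_dcube hb hy
    linarith
  unfold Ddist
  linarith

lemma measurableSet_dcube (n : ℕ) (k : ℤ) (m : Fin n → ℤ) : MeasurableSet (dcube n k m) := by
  have : dcube n k m = Set.univ.pi fun i =>
      Set.Ico ((m i : ℝ) * (2:ℝ) ^ (-k)) (((m i : ℝ) + 1) * (2:ℝ) ^ (-k)) := by
    ext x
    simp [dcube, Set.mem_pi]
  rw [this]
  exact MeasurableSet.univ_pi fun i => measurableSet_Ico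

lemma pairwise_disjoint_dcube (n : ℕ) (k : ℤ) :
    Pairwise (Function.onFun Disjoint fun m : Fin n → ℤ => dcube n k m) := by
  intro m m' hne
  rw [Function.onFun, Set.disjoint_left]
  intro x hx hx'
  apply hne
  funext i
  have h : (0:ℝ) < 2 ^ (-k) := by positivity
  have h1 : (m i : ℝ) < m' i + 1 := lt_of_mul_lt_mul_right ((hx i).1.trans_lt (hx' i).2) h.le
  have h2 : (m' i : ℝ) < m i + 1 := lt_of_mul_lt_mul_right ((hx' i).1.trans_lt (hx i).2) h.le
  norm_cast at h1 h2
  omega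

/-- The cubes of one generation at distance less than `r` from a cube have total measure at most
that of a ball of radius `r`. -/
lemma tsum_measure_dcube_le {n : ℕ} (μ : Measure (Fin n → ℝ)) (k : ℤ) (q : ℤ × (Fin n → ℤ))
    (r : ℝ) :
    ∑' m : Fin n → ℤ, (if Ddist n (k, m) q < r then μ (dcube n k m) else 0) ≤
      μ (Metric.ball (dcorner n q) r) := by
  calc _ ≤ ∑' m : Fin n → ℤ, μ (dcube n k m ∩ Metric.ball (dcorner n q) r) := by
        refine ENNReal.tsum_le_tsum fun m => ?_
        split_ifs with h
        · refine measure_mono fun x hx => ⟨hx, ?_⟩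
          exact (dist_le_Ddist (p := (k, m)) hx (dcorner_mem n q)).trans_lt h
        · exact zero_le
    _ ≤ μ (⋃ m : Fin n → ℤ, dcube n k m ∩ Metric.ball (dcorner n q) r) := by
        refine tsum_meas_le_meas_iUnion_of_disjoint μ
          (fun m => (measurableSet_dcube n k m).inter measurableSet_ball) fun m m' hne => ?_
        exact (pairwise_disjoint_dcube n k hne).mono inter_subset_left inter_subset_left
    _ ≤ _ := measure_mono (iUnion_subset fun m => inter_subset_right)

lemma rpow_mul_rpow_div_max_rpow (α : ℝ) (k l : ℤ) :
    (((2:ℝ) ^ (-k)) ^ (α / 2) * ((2:ℝ) ^ (-l)) ^ (α / 2)) /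
      (max ((2:ℝ) ^ (-k)) ((2:ℝ) ^ (-l))) ^ α = ((2:ℝ) ^ (-(α / 2))) ^ (k - l).natAbs := by
  have key : ∀ i : ℤ, (2:ℝ) ^ i = (2:ℝ) ^ (i : ℝ) := fun i => (Real.rpow_intCast 2 i).symm
  have h2 : (0:ℝ) < 2 := two_pos
  wlog h : k ≤ l generalizing k l
  · rw [max_comm, mul_comm, this l k (by omega)]
    congr 1
    omega
  have hc : ((k - l).natAbs : ℝ) = (l : ℝ) - k := by
    have : (((k - l).natAbs : ℤ) : ℝ) = ((l - k : ℤ) : ℝ) := by congr 1; omega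
    push_cast at this
    simpa using this
  rw [max_eq_left (zpow_le_zpow_right₀ one_le_two (by omega)), ← Real.rpow_natCast, hc, key, key,
    ← Real.rpow_mul h2.le, ← Real.rpow_mul h2.le, ← Real.rpow_mul h2.le, ← Real.rpow_mul h2.le,
    ← Real.rpow_add h2, ← Real.rpow_sub h2]
  congr 1
  push_cast
  ring

/-- The kernel is dominated by the contribution of the dyadic shell containing `D(Q,R)`. -/
lemma Akernel_le_tsum {n : ℕ} {α : ℝ} (hα : 0 < α) {lam : (Fin n → ℝ) → ℝ → ℝ}
    (hpos : ∀ x r, 0 < r → 0 < lam x r)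
    (hmono : ∀ x r r', 0 < r → r ≤ r' → lam x r ≤ lam x r') (p q : ℤ × (Fin n → ℤ)) :
    Akernel n α lam p q ≤ ∑' j : ℕ,
      if Ddist n p q < 2 * (2 ^ j * max ((2:ℝ) ^ (-p.1)) ((2:ℝ) ^ (-q.1))) then
        ENNReal.ofReal (((2:ℝ) ^ (-(α / 2))) ^ (p.1 - q.1).natAbs * ((2:ℝ) ^ (-α)) ^ j /
          lam (dcorner n q) (2 ^ j * max ((2:ℝ) ^ (-p.1)) ((2:ℝ) ^ (-q.1)))) else 0 := by
  set L := max ((2:ℝ) ^ (-p.1)) ((2:ℝ) ^ (-q.1)) with hL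
  have hL0 : 0 < L := lt_max_of_lt_left (by positivity)
  have hLD : L ≤ Ddist n p q := max_le_Ddist n p q
  set D := Ddist n p q with hD
  by_cases hb : BddAbove (range fun z : (dcube n p.1 p.2 ∪ dcube n q.1 q.2 :
      Set (Fin n → ℝ)) => lam z D)
  swap
  · have : Akernel n α lam p q = 0 := by
      unfold Akernel
      rw [← hD, iSup, Real.sSup_of_not_bddAbove hb]
      simp
    rw [this]
    exact zero_le
  obtain ⟨j, hj1, hj2⟩ := exists_nat_pow_near ((one_le_div hL0).2 hLD) (one_lt_two (α := ℝ))
  rw [le_div_iff₀ hL0] at hj1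
  rw [div_lt_iff₀ hL0] at hj2
  have hsL : 0 < 2 ^ j * L := by positivity
  refine le_trans ?_ (ENNReal.le_tsum j)
  rw [if_pos (by rw [pow_succ] at hj2; linarith)]
  unfold Akernel
  apply ENNReal.ofReal_le_ofReal
  rw [← hD, ← rpow_mul_rpow_div_max_rpow α p.1 q.1, ← hL]
  have hsup := le_ciSup hb ⟨dcorner n q, Or.inr (dcorner_mem n q)⟩
  dsimp only at hsup
  have hlam := hpos (dcorner n q) _ hsL
  have hlam2 := hmono (dcorner n q) _ _ hsL hj1
  have hpow : (2 ^ j * L) ^ α ≤ D ^ α := Real.rpow_le_rpow hsL.le hj1 hα.le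
  have hpow0 : 0 < (2 ^ j * L) ^ α := Real.rpow_pos_of_pos hsL α
  have h2j : ((2:ℝ) ^ (-α)) ^ j = (((2:ℝ) ^ j) ^ α)⁻¹ := by
    rw [Real.rpow_neg two_pos.le, inv_pow, Real.rpow_pow_comm two_pos.le]
  calc _ ≤ (((2:ℝ) ^ (-p.1)) ^ (α / 2) * ((2:ℝ) ^ (-q.1)) ^ (α / 2)) /
        ((2 ^ j * L) ^ α * lam (dcorner n q) (2 ^ j * L)) := by
        apply div_le_div_of_nonneg_left (by positivity) (by positivity)
        exact mul_le_mul hpow (hlam2.trans hsup) hlam.le (hpow0.le.trans hpow)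
    _ = _ := by
        rw [h2j, Real.mul_rpow (by positivity) hL0.le]
        have : 0 < L ^ α := Real.rpow_pos_of_pos hL0 α
        have : 0 < ((2:ℝ) ^ j) ^ α := by positivity
        field_simp

/-- The constant in the Schur test for the kernel `Akernel`. -/
def schurConst (α Clam : ℝ) : ℝ≥0∞ :=
  ENNReal.ofReal Clam * ((∑' i : ℤ, ENNReal.ofReal (((2:ℝ) ^ (-(α / 2))) ^ i.natAbs)) *
    ∑' j : ℕ, ENNReal.ofReal (((2:ℝ) ^ (-α)) ^ j))

lemma schurConst_ne_top {α : ℝ} (hα : 0 < α) (Clam : ℝ) : schurConst α Clam ≠ ⊤ := by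
  have h : ∀ a : ℝ, 0 < a → Summable fun j : ℕ => ((2:ℝ) ^ (-a)) ^ j := fun a ha =>
    summable_geometric_of_lt_one (by positivity)
      (Real.rpow_lt_one_of_one_lt_of_neg one_lt_two (by linarith))
  have hs : Summable fun i : ℤ => ((2:ℝ) ^ (-(α / 2))) ^ i.natAbs :=
    Summable.of_nat_of_neg (by simpa using h (α / 2) (by linarith))
      (by simpa using h (α / 2) (by linarith))
  exact ENNReal.mul_ne_top ENNReal.ofReal_ne_top
    (ENNReal.mul_ne_top hs.tsum_ofReal_ne_top (h α hα).tsum_ofReal_ne_top)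

/-- The Schur test condition for the kernel `Akernel` with respect to the weights `μ(Q)`. -/
lemma tsum_Akernel_mul_measure_le {n : ℕ} {α Clam : ℝ} (hα : 0 < α) (hClam : 1 ≤ Clam)
    {μ : Measure (Fin n → ℝ)} {lam : (Fin n → ℝ) → ℝ → ℝ}
    (hpos : ∀ x r, 0 < r → 0 < lam x r)
    (hmono : ∀ x r r', 0 < r → r ≤ r' → lam x r ≤ lam x r')
    (hdoub : ∀ x r, 0 < r → lam x (2 * r) ≤ Clam * lam x r)
    (hμ : ∀ x r, 0 < r → μ (Metric.ball x r) ≤ ENNReal.ofReal (lam x r))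
    (q : ℤ × (Fin n → ℤ)) :
    ∑' p : ℤ × (Fin n → ℤ), Akernel n α lam p q * μ (dcube n p.1 p.2) ≤ schurConst α Clam := by
  set L : ℤ → ℝ := fun k => max ((2:ℝ) ^ (-k)) ((2:ℝ) ^ (-q.1)) with hL
  have hL0 : ∀ k, 0 < L k := fun k => lt_max_of_lt_left (by positivity)
  set a : ℤ → ℕ → ℝ := fun k j =>
    ((2:ℝ) ^ (-(α / 2))) ^ (k - q.1).natAbs * ((2:ℝ) ^ (-α)) ^ j with ha
  have ha0 : ∀ k j, 0 ≤ a k j := fun k j => by positivity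
  set G : ℤ → ℕ → ℝ≥0∞ := fun k j =>
    ENNReal.ofReal (a k j / lam (dcorner n q) (2 ^ j * L k)) with hG
  have hGle : ∀ k j, G k j * μ (Metric.ball (dcorner n q) (2 * (2 ^ j * L k))) ≤
      ENNReal.ofReal Clam * ENNReal.ofReal (a k j) := by
    intro k j
    have hr : 0 < 2 ^ j * L k := mul_pos (by positivity) (hL0 k)
    have hl := hpos (dcorner n q) _ hr
    calc _ ≤ G k j * ENNReal.ofReal (Clam * lam (dcorner n q) (2 ^ j * L k)) := by
          gcongr
          exact (hμ _ _ (by positivity)).trans (ENNReal.ofReal_le_ofReal (hdoub _ _ hr))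
      _ = _ := by
          rw [hG, ← ENNReal.ofReal_mul (div_nonneg (ha0 k j) hl.le),
            ← ENNReal.ofReal_mul (by linarith)]
          congr 1
          field_simp
  calc _ = ∑' (k : ℤ) (m : Fin n → ℤ), Akernel n α lam (k, m) q * μ (dcube n k m) :=
        ENNReal.tsum_prod' (f := fun p : ℤ × (Fin n → ℤ) =>
          Akernel n α lam p q * μ (dcube n p.1 p.2))
    _ ≤ ∑' (k : ℤ) (m : Fin n → ℤ) (j : ℕ),
          G k j * (if Ddist n (k, m) q < 2 * (2 ^ j * L k) then μ (dcube n k m) else 0) := by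
        refine ENNReal.tsum_le_tsum fun k => ENNReal.tsum_le_tsum fun m => ?_
        refine (mul_le_mul_left (Akernel_le_tsum hα hpos hmono (k, m) q) _).trans_eq ?_
        rw [← ENNReal.tsum_mul_right]
        refine tsum_congr fun j => ?_
        rw [ite_mul, mul_ite, zero_mul, mul_zero]
    _ ≤ ∑' (k : ℤ) (j : ℕ), ENNReal.ofReal Clam * ENNReal.ofReal (a k j) := by
        refine ENNReal.tsum_le_tsum fun k => ?_
        rw [ENNReal.tsum_comm]
        refine ENNReal.tsum_le_tsum fun j => ?_
        rw [ENNReal.tsum_mul_left]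
        exact (mul_le_mul_right (tsum_measure_dcube_le μ k q _) _).trans (hGle k j)
    _ = schurConst α Clam := by
        simp only [ENNReal.tsum_mul_left, schurConst, ha]
        congr 1
        rw [← (Equiv.addRight q.1).tsum_eq, ← ENNReal.tsum_mul_right]
        refine tsum_congr fun k => ?_
        rw [← ENNReal.tsum_mul_left]
        refine tsum_congr fun j => ?_
        rw [ENNReal.ofReal_mul (by positivity), Equiv.coe_addRight, add_sub_cancel_right]

lemma ENNReal.tsum_mul_sq_le {ι : Type*} (f g : ι → ℝ≥0∞) :
    (∑' i, f i * g i) ^ 2 ≤ (∑' i, f i ^ 2) * ∑' i, g i ^ 2 := by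
  let _ : MeasurableSpace ι := ⊤
  have h := ENNReal.lintegral_mul_le_Lp_mul_Lq (Measure.count : Measure ι)
    Real.HolderConjugate.two_two (f := f) (g := g) measurable_from_top.aemeasurable
    measurable_from_top.aemeasurable
  simp only [lintegral_count, Pi.mul_apply, ENNReal.rpow_two] at h
  refine (pow_le_pow_left' h 2).trans_eq ?_
  rw [mul_pow, ← ENNReal.rpow_two, ← ENNReal.rpow_two, ← ENNReal.rpow_mul, ← ENNReal.rpow_mul]
  norm_num

/-- A Schur test for the matrix `K p q * w p * w q` with symmetric `K`. -/
lemma tsum_sq_tsum_le_of_schur {ι : Type*} {K : ι → ι → ℝ≥0∞} (hK : ∀ p q, K p q = K q p)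
    (w : ι → ℝ≥0∞) {C : ℝ≥0∞} (hC : ∀ q, ∑' p, K p q * w p ^ 2 ≤ C) (x : ι → ℝ≥0∞) :
    ∑' q, (∑' p, K p q * w p * w q * x p) ^ 2 ≤ C ^ 2 * ∑' p, x p ^ 2 := by
  have hsq : ∀ a : ℝ≥0∞, (a ^ ((1:ℝ) / 2)) ^ 2 = a := fun a => by
    rw [← ENNReal.rpow_two, ← ENNReal.rpow_mul]
    norm_num
  calc _ ≤ ∑' q, C * ∑' p, K p q * w q ^ 2 * x p ^ 2 := by
        refine ENNReal.tsum_le_tsum fun q => ?_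
        calc _ = (∑' p, (K p q ^ ((1:ℝ) / 2) * w p) *
                (K p q ^ ((1:ℝ) / 2) * w q * x p)) ^ 2 := by
              congr 1
              refine tsum_congr fun p => ?_
              conv_lhs => rw [← hsq (K p q)]
              ring
          _ ≤ _ := ENNReal.tsum_mul_sq_le _ _
          _ ≤ _ := by
              simp only [mul_pow, hsq]
              exact mul_le_mul_left (hC q) _
    _ = C * ∑' p, x p ^ 2 * ∑' q, K q p * w q ^ 2 := by
        rw [ENNReal.tsum_mul_left, ENNReal.tsum_comm]
        congr 1
        refine tsum_congr fun p => ?_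
        rw [← ENNReal.tsum_mul_left]
        refine tsum_congr fun q => ?_
        rw [hK p q, mul_comm]
    _ ≤ C * ∑' p, x p ^ 2 * C := by
        gcongr with p
        exact hC p
    _ = _ := by
        rw [ENNReal.tsum_mul_right]
        ring

/-- **(Proposition 6.3 of [HM], second form).** For every nonnegative sequence `(x_Q)` indexed
by the dyadic cubes, `(Σ_R [Σ_Q A_{QR} x_Q]²)^{1/2} ≲ (Σ_Q x_Q²)^{1/2}`, with constant
depending only on `n`, `α`, `C_λ`. -/
theorem Amat_l2_operator_bound
    (n : ℕ) (hn : 0 < n) (α Clam : ℝ) (hα : 0 < α) (hClam : 1 ≤ Clam) :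
    ∃ C : ℝ, 0 < C ∧
      ∀ (μ : Measure (Fin n → ℝ)) (lam : (Fin n → ℝ) → ℝ → ℝ),
        (∀ x r, 0 < r → 0 < lam x r) →
        (∀ x r r', 0 < r → r ≤ r' → lam x r ≤ lam x r') →
        (∀ x r, 0 < r → lam x (2 * r) ≤ Clam * lam x r) →
        (∀ x r, 0 < r → μ (Metric.ball x r) ≤ ENNReal.ofReal (lam x r)) →
        ∀ x : ℤ × (Fin n → ℤ) → ℝ≥0∞,
          (∑' q : ℤ × (Fin n → ℤ),
              (∑' p : ℤ × (Fin n → ℤ), Amat n α μ lam p q * x p) ^ 2) ^ ((1:ℝ) / 2)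
            ≤ ENNReal.ofReal C * (∑' p, x p ^ 2) ^ ((1:ℝ) / 2) := by
  have htop := schurConst_ne_top hα Clam
  refine ⟨(schurConst α Clam).toReal + 1, by positivity, ?_⟩
  intro μ lam hpos hmono hdoub hμ x
  have hsq : ∀ a : ℝ≥0∞, (a ^ ((1:ℝ) / 2)) ^ 2 = a := fun a => by
    rw [← ENNReal.rpow_two, ← ENNReal.rpow_mul]
    norm_num
  have hschur := tsum_sq_tsum_le_of_schur (Akernel_comm n α lam)
    (fun p => μ (dcube n p.1 p.2) ^ ((1:ℝ) / 2)) (C := schurConst α Clam)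
    (fun q => by
      simp only [hsq]
      exact tsum_Akernel_mul_measure_le hα hClam hpos hmono hdoub hμ q) x
  refine (ENNReal.rpow_le_rpow hschur (by norm_num : (0:ℝ) ≤ 1 / 2)).trans ?_
  rw [ENNReal.mul_rpow_of_nonneg _ _ (by norm_num), ← ENNReal.rpow_two, ← ENNReal.rpow_mul]
  norm_num
  gcongr
  rw [ENNReal.le_ofReal_iff_toReal_le htop (by positivity)]
  linarith
end
end

section
/- Let S ⊂ ℝⁿ be a cube, R ⊂ S a cube with d(R, ℝⁿ \ S) ≥ ℓ(R)^{1/2} ℓ(S)^{1/2}, and let b ∈ L^∞(μ). Then for every (x,t) ∈ W_R = R × (ℓ(R)/2, ℓ(R)), |θ_t(χ_{ℝⁿ \ S} b)(x)| ≲ ‖b‖_∞ · (ℓ(R)/ℓ(S))^{α/2}. -/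
open MeasureTheory Set

noncomputable section

/-- The axis-parallel cube in `ℝⁿ` (with the `ℓ^∞` metric) with center `c` and sidelength `L`,
realized as the closed `ℓ^∞` ball of radius `L/2`. -/
def Cube {n : ℕ} (c : Fin n → ℝ) (L : ℝ) : Set (Fin n → ℝ) :=
  Metric.closedBall c (L / 2)

/-- If the open balls about `x` satisfy `μ (B(x,r)) ≤ l r` for a non-decreasing doubling function
`l`, then `d(x,y)^{-α} / l (d(x,y))` integrates over `d(x,y) ≥ r` to `≲ r^{-α}`. -/
theorem lintegral_dist_rpow_mul_inv_le {X : Type*} [PseudoMetricSpace X] [MeasurableSpace X]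
    (μ : Measure X) (x : X) (l : ℝ → ℝ) {α K r : ℝ} (hα : 0 < α) (hK : 0 ≤ K) (hr : 0 < r)
    (hpos : ∀ ρ, 0 < ρ → 0 < l ρ) (hmono : ∀ ρ ρ', 0 < ρ → ρ ≤ ρ' → l ρ ≤ l ρ')
    (hdoub : ∀ ρ, 0 < ρ → l (2 * ρ) ≤ K * l ρ)
    (hball : ∀ ρ, 0 < ρ → μ (Metric.ball x ρ) ≤ ENNReal.ofReal (l ρ)) :
    ∫⁻ y in {y | r ≤ dist x y}, ENNReal.ofReal ((dist x y ^ α * l (dist x y))⁻¹) ∂μ ≤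
      ENNReal.ofReal (K * (1 - ((2 : ℝ) ^ α)⁻¹)⁻¹ * (r ^ α)⁻¹) := by
  set q : ℝ := ((2 : ℝ) ^ α)⁻¹ with hq
  have hq0 : 0 ≤ q := by positivity
  have hq1 : q < 1 := inv_lt_one_of_one_lt₀ (Real.one_lt_rpow one_lt_two hα)
  have hρ : ∀ k : ℕ, 0 < 2 ^ k * r := fun k => by positivity
  have hcover : {y | r ≤ dist x y} ⊆
      ⋃ k : ℕ, {y | 2 ^ k * r ≤ dist x y ∧ dist x y < 2 * (2 ^ k * r)} := by
    intro y hy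
    obtain ⟨k, hk₁, hk₂⟩ := exists_nat_pow_near
      ((one_le_div hr).2 (show r ≤ dist x y from hy)) one_lt_two
    refine mem_iUnion.2 ⟨k, (le_div_iff₀ hr).1 hk₁, ?_⟩
    have := (div_lt_iff₀ hr).1 hk₂
    rw [pow_succ] at this
    linarith
  have hannulus : ∀ k : ℕ,
      ∫⁻ y in {y | 2 ^ k * r ≤ dist x y ∧ dist x y < 2 * (2 ^ k * r)},
        ENNReal.ofReal ((dist x y ^ α * l (dist x y))⁻¹) ∂μ ≤
      ENNReal.ofReal (K * (r ^ α)⁻¹ * q ^ k) := by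
    intro k
    have hl := hpos _ (hρ k)
    calc _ ≤ ∫⁻ y in {y | 2 ^ k * r ≤ dist x y ∧ dist x y < 2 * (2 ^ k * r)},
            ENNReal.ofReal (((2 ^ k * r) ^ α * l (2 ^ k * r))⁻¹) ∂μ := by
          refine setLIntegral_mono measurable_const fun y hy => ?_
          have h₁ := hy.1
          have h₂ := hmono _ _ (hρ k) hy.1
          gcongr
      _ = ENNReal.ofReal (((2 ^ k * r) ^ α * l (2 ^ k * r))⁻¹) *
            μ {y | 2 ^ k * r ≤ dist x y ∧ dist x y < 2 * (2 ^ k * r)} :=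
          setLIntegral_const _ _
      _ ≤ ENNReal.ofReal (((2 ^ k * r) ^ α * l (2 ^ k * r))⁻¹) *
            ENNReal.ofReal (K * l (2 ^ k * r)) := by
          gcongr
          refine (measure_mono fun y hy => ?_).trans ((hball (2 * (2 ^ k * r))
            (by positivity)).trans (ENNReal.ofReal_le_ofReal (hdoub _ (hρ k))))
          rw [Metric.mem_ball']
          exact hy.2
      _ = ENNReal.ofReal (K * (r ^ α)⁻¹ * q ^ k) := by
          rw [← ENNReal.ofReal_mul (by positivity)]
          congr 1
          rw [Real.mul_rpow (by positivity) hr.le, ← Real.rpow_pow_comm zero_le_two, hq, inv_pow]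
          field_simp
  calc _ ≤ ∫⁻ y in ⋃ k : ℕ, {y | 2 ^ k * r ≤ dist x y ∧ dist x y < 2 * (2 ^ k * r)},
            ENNReal.ofReal ((dist x y ^ α * l (dist x y))⁻¹) ∂μ := lintegral_mono_set hcover
    _ ≤ ∑' k : ℕ, ENNReal.ofReal (K * (r ^ α)⁻¹ * q ^ k) :=
        (lintegral_iUnion_le _ _).trans (ENNReal.tsum_le_tsum hannulus)
    _ = _ := by
        rw [← ENNReal.ofReal_tsum_of_nonneg (fun k => by positivity)
          ((summable_geometric_of_lt_one hq0 hq1).mul_left _), tsum_mul_left,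
          tsum_geometric_of_lt_one hq0 hq1]
        ring_nf

theorem sdist_le_dist {n : ℕ} {A B : Set (Fin n → ℝ)} {x y : Fin n → ℝ} (hx : x ∈ A)
    (hy : y ∈ B) : sdist A B ≤ dist x y := by
  refine csInf_le ⟨0, ?_⟩ (mem_image2_of_mem hx hy)
  rintro _ ⟨u, _, v, _, rfl⟩
  exact dist_nonneg

/-- **Tail estimate.** If `R ⊆ S` are cubes with `d(R, ℝⁿ ∖ S) ≥ ℓ(R)^{1/2} ℓ(S)^{1/2}` and
`b ∈ L^∞(μ)`, then for every `(x,t) ∈ W_R = R × (ℓ(R)/2, ℓ(R))` one has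
`|θ_t(χ_{ℝⁿ ∖ S} b)(x)| ≲ ‖b‖_∞ (ℓ(R)/ℓ(S))^{α/2}`. -/
theorem theta_of_exterior_bound
    (n : ℕ) (hn : 0 < n) (α Clam Cs Csym : ℝ)
    (hα : 0 < α) (hClam : 1 ≤ Clam) (hCs : 0 < Cs) (hCsym : 1 ≤ Csym) :
    ∃ C : ℝ, 0 < C ∧
      ∀ (μ : Measure (Fin n → ℝ)) (lam : (Fin n → ℝ) → ℝ → ℝ)
        (s : ℝ → (Fin n → ℝ) → (Fin n → ℝ) → ℝ),
        (∀ x r, 0 < r → 0 < lam x r) →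
        (∀ x r r', 0 < r → r ≤ r' → lam x r ≤ lam x r') →
        (∀ x r, 0 < r → lam x (2 * r) ≤ Clam * lam x r) →
        (∀ x r, 0 < r → μ (Metric.ball x r) ≤ ENNReal.ofReal (lam x r)) →
        (∀ x y r, 0 < r → dist x y ≤ r → lam x r ≤ Csym * lam y r) →
        (∀ t x y, 0 < t →
          |s t x y| ≤ Cs * t ^ α / (t ^ α * lam x t + dist x y ^ α * lam x (dist x y))) →
        ∀ (cS : Fin n → ℝ) (LS : ℝ) (cR : Fin n → ℝ) (LR : ℝ),
          0 < LS → 0 < LR →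
          Cube cR LR ⊆ Cube cS LS →
          LR ^ ((1:ℝ) / 2) * LS ^ ((1:ℝ) / 2) ≤ sdist (Cube cR LR) ((Cube cS LS)ᶜ) →
          ∀ (b : (Fin n → ℝ) → ℝ) (B : ℝ), Measurable b → (∀ x, |b x| ≤ B) →
            ∀ x ∈ Cube cR LR, ∀ t : ℝ, LR / 2 < t → t < LR →
              |∫ y in (Cube cS LS)ᶜ, s t x y * b y ∂μ| ≤ C * B * (LR / LS) ^ (α / 2) := by
  have hq : 0 < 1 - ((2 : ℝ) ^ α)⁻¹ :=
    sub_pos.2 (inv_lt_one_of_one_lt₀ (Real.one_lt_rpow one_lt_two hα))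
  refine ⟨Cs * (Clam * (1 - ((2 : ℝ) ^ α)⁻¹)⁻¹), by positivity, ?_⟩
  intro μ lam s hpos hmono hdoub hball _ hs cS LS cR LR hLS hLR _ hdist b B _ hb x hx t ht₁ ht₂
  have ht : 0 < t := by linarith
  have hB : 0 ≤ B := (abs_nonneg _).trans (hb x)
  set r : ℝ := LR ^ ((1 : ℝ) / 2) * LS ^ ((1 : ℝ) / 2) with hr_def
  have hr : 0 < r := by positivity
  have hsub : (Cube cS LS)ᶜ ⊆ {y | r ≤ dist x y} := fun y hy =>
    hdist.trans (sdist_le_dist hx hy)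
  have hmeas : MeasurableSet {y | r ≤ dist x y} :=
    measurableSet_le measurable_const (measurable_const.dist measurable_id)
  have hratio : LR ^ α * (r ^ α)⁻¹ = (LR / LS) ^ (α / 2) := by
    rw [hr_def, Real.mul_rpow (by positivity) (by positivity), ← Real.rpow_mul hLR.le,
      ← Real.rpow_mul hLS.le, Real.div_rpow hLR.le hLS.le,
      show (1 : ℝ) / 2 * α = α / 2 by ring]
    have : LR ^ α = LR ^ (α / 2) * LR ^ (α / 2) := by
      rw [← Real.rpow_add hLR, add_halves]
    rw [this]
    field_simp
  have hpoint : ∀ y ∈ {y | r ≤ dist x y}, ‖s t x y * b y‖ₑ ≤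
      ENNReal.ofReal (Cs * LR ^ α * B) *
        ENNReal.ofReal ((dist x y ^ α * lam x (dist x y))⁻¹) := by
    intro y hy
    have hd : 0 < dist x y := hr.trans_le hy
    have hl := hpos x _ hd
    have hlt := hpos x _ ht
    rw [← ENNReal.ofReal_mul (by positivity), Real.enorm_eq_ofReal_abs, abs_mul]
    refine ENNReal.ofReal_le_ofReal ?_
    calc |s t x y| * |b y| ≤
          Cs * t ^ α / (t ^ α * lam x t + dist x y ^ α * lam x (dist x y)) * B := by
          gcongr
          exacts [hs t x y ht, hb y]
      _ ≤ Cs * LR ^ α / (dist x y ^ α * lam x (dist x y)) * B := by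
          gcongr
          exact le_add_of_nonneg_left (by positivity)
      _ = _ := by ring
  have hmain : ‖∫ y in (Cube cS LS)ᶜ, s t x y * b y ∂μ‖ₑ ≤ ENNReal.ofReal
      (Cs * LR ^ α * B * (Clam * (1 - ((2 : ℝ) ^ α)⁻¹)⁻¹ * (r ^ α)⁻¹)) :=
    calc _ ≤ ∫⁻ y in (Cube cS LS)ᶜ, ‖s t x y * b y‖ₑ ∂μ := enorm_integral_le_lintegral_enorm _
      _ ≤ ∫⁻ y in {y | r ≤ dist x y}, ‖s t x y * b y‖ₑ ∂μ := lintegral_mono_set hsub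
      _ ≤ ∫⁻ y in {y | r ≤ dist x y}, ENNReal.ofReal (Cs * LR ^ α * B) *
            ENNReal.ofReal ((dist x y ^ α * lam x (dist x y))⁻¹) ∂μ :=
          setLIntegral_mono' hmeas hpoint
      _ = ENNReal.ofReal (Cs * LR ^ α * B) * ∫⁻ y in {y | r ≤ dist x y},
            ENNReal.ofReal ((dist x y ^ α * lam x (dist x y))⁻¹) ∂μ :=
          lintegral_const_mul' _ _ ENNReal.ofReal_ne_top
      _ ≤ _ := by
          rw [ENNReal.ofReal_mul (p := Cs * LR ^ α * B) (by positivity)]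
          exact mul_le_mul_right (lintegral_dist_rpow_mul_inv_le μ x (lam x) hα (by linarith) hr
            (hpos x) (hmono x) (hdoub x) (hball x)) _
  rw [Real.enorm_eq_ofReal_abs, ENNReal.ofReal_le_ofReal_iff (by positivity)] at hmain
  refine hmain.trans_eq ?_
  rw [← hratio]
  ring
end
end
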